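/- For every integer m ≥ 1 and t ∈ (0,1) with L := log(1/t) satisfying 0 < L < 2π, Lerch's formula holds: ∑_{k=0}^∞ t^{k+1}/(k+1)^m = ((-1)^m/(m-1)!) L^{m-1} log L + ∑'_{k=0}^∞ ((-1)^k/k!) ζ(m-k) L^k, where the prime means that in the term k = m-1 the value ζ(1) is replaced by the harmonic number ∑_{j=1}^{m-1} 1/j. -/

import Mathlib

open Filter Topology

theorem ps_summable (c b : ℕ → ℝ) (R : ℝ)
    (hb : ∀ r, 0 ≤ r → r < R → Summable fun k => |b k| * r ^ k)
    (hc : ∀ k : ℕ, c (k+1) * ((k:ℝ)+1) = b k) :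
    ∀ r, 0 ≤ r → r < R → Summable fun k => |c k| * r ^ k := by
  intro r h0 hr
  rw [← summable_nat_add_iff 1]
  refine Summable.of_nonneg_of_le (fun k => by positivity) (fun k => ?_) ((hb r h0 hr).mul_right r)
  rw [← hc k, abs_mul, pow_succ]
  have h1 : (1:ℝ) ≤ |(k:ℝ)+1| := by
    rw [abs_of_nonneg (by positivity)]; simp
  have : |c (k+1)| ≤ |c (k+1)| * |(k:ℝ)+1| := le_mul_of_one_le_right (abs_nonneg _) h1
  calc |c (k+1)| * (r^k * r) ≤ (|c (k+1)| * |(k:ℝ)+1|) * (r^k * r) := by gcongr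
    _ = _ := by ring

theorem ps_sum' (c : ℕ → ℝ) (R : ℝ)
    (hc : ∀ r, 0 ≤ r → r < R → Summable fun k => |c k| * r ^ k) (x : ℝ) (hx : |x| < R) :
    Summable fun k => c k * x ^ k := by
  have := hc |x| (abs_nonneg x) hx
  refine Summable.of_norm ?_
  simpa [norm_mul, norm_pow] using this

theorem ps_deriv (c b : ℕ → ℝ) (R : ℝ)
    (hb : ∀ r, 0 ≤ r → r < R → Summable fun k => |b k| * r ^ k)
    (hc : ∀ k : ℕ, c (k+1) * ((k:ℝ)+1) = b k) (x : ℝ) (hx : |x| < R) :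
    HasDerivAt (fun x => ∑' k, c k * x ^ k) (∑' k, b k * x ^ k) x := by
  obtain ⟨r, hxr, hrR⟩ := exists_between hx
  have hr0 : 0 ≤ r := (abs_nonneg x).trans hxr.le
  have hs := ps_sum' c R (ps_summable c b R hb hc)
  have hd : HasDerivAt (fun x => ∑' k, c (k+1) * x ^ (k+1)) (∑' k, b k * x ^ k) x := by
    refine hasDerivAt_tsum_of_isPreconnected (t := Set.Ioo (-r) r) (y₀ := x)
      (g := fun k x => c (k+1) * x ^ (k+1)) (g' := fun k x => b k * x ^ k)
      (hb r hr0 hrR) isOpen_Ioo isPreconnected_Ioo ?_ ?_ (abs_lt.1 hxr) ?_ (abs_lt.1 hxr)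
    · intro k y _
      have := (hasDerivAt_pow (k+1) y).const_mul (c (k+1))
      convert! this using 1
      rw [← hc k]; push_cast; ring
    · intro k y hy
      rw [norm_mul, norm_pow, Real.norm_eq_abs, Real.norm_eq_abs]
      have := (abs_lt.2 hy).le
      gcongr
    · exact (summable_nat_add_iff (f := fun k => c k * x ^ k) 1).2 (hs x hx)
  refine (hd.const_add (c 0)).congr_of_eventuallyEq ?_
  have : ∀ᶠ y in 𝓝 x, |y| < R := (continuous_abs.tendsto x).eventually (gt_mem_nhds hx)
  filter_upwards [this] with y hy
  rw [(hs y hy).tsum_eq_zero_add]; simp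

theorem zero_of_deriv (D : ℝ → ℝ) (R : ℝ) (hD : ∀ x ∈ Set.Ioo 0 R, HasDerivAt D 0 x)
    (hl : Tendsto D (𝓝[>] 0) (𝓝 0)) : ∀ x ∈ Set.Ioo 0 R, D x = 0 := by
  intro x hx
  have hR : 0 < R := hx.1.trans hx.2
  obtain ⟨a, ha⟩ := IsOpen.exists_is_const_of_deriv_eq_zero (f := D) (s := Set.Ioo 0 R) isOpen_Ioo
    isPreconnected_Ioo (fun x hx => (hD x hx).differentiableAt.differentiableWithinAt)
    (fun x hx => (hD x hx).deriv)
  have : Tendsto D (𝓝[>] 0) (𝓝 a) := by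
    refine tendsto_const_nhds.congr' ?_
    filter_upwards [Ioo_mem_nhdsGT hR] with y hy using (ha y hy).symm
  rw [ha x hx, tendsto_nhds_unique this hl]

theorem bern_bound (k : ℕ) : |(bernoulli k : ℝ) / k.factorial| ≤ 10 / (2 * Real.pi) ^ k := by
  have hp := Real.pi_gt_three
  have hp4 := Real.pi_le_four
  have hp3 := Real.pi_lt_d2
  rcases Nat.even_or_odd k with he | ho
  · obtain ⟨j, rfl⟩ := he
    rw [← two_mul]
    rcases eq_or_ne j 0 with rfl | hj
    · simp
    have h1 := hasSum_zeta_nat hj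
    have h2 := hasSum_le (fun n : ℕ => ?_) h1 hasSum_zeta_two
    · have h3 := h1.nonneg (fun n => by positivity)
      rw [← abs_of_nonneg h3] at h2
      have e : (-1 : ℝ) ^ (j + 1) * (2 : ℝ) ^ (2 * j - 1) * Real.pi ^ (2 * j) *
        bernoulli (2 * j) / (2 * j).factorial =
        (-1 : ℝ) ^ (j + 1) * ((2 : ℝ) ^ (2 * j - 1) * Real.pi ^ (2 * j)) *
        (bernoulli (2 * j) / (2 * j).factorial) := by ring
      rw [e, abs_mul, abs_mul, abs_pow, abs_neg, abs_one, one_pow, one_mul,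
        abs_of_nonneg (a := _ * _) (by positivity)] at h2
      rw [le_div_iff₀ (by positivity)]
      have e2 : (2:ℝ) ^ (2*j) = 2 * 2 ^ (2*j-1) := by
        rw [← pow_succ']; congr 1; omega
      rw [mul_pow, e2]
      nlinarith
    · rcases Nat.eq_zero_or_pos n with rfl | hn
      · simp [hj]
      · have : (1:ℝ) ≤ n := by exact_mod_cast hn
        apply one_div_le_one_div_of_le (by positivity)
        exact pow_le_pow_right₀ this (by omega)
  · rcases eq_or_ne k 1 with rfl | h1
    · rw [bernoulli_one]; norm_num
      rw [div_le_div_iff₀ (by positivity) (by positivity)]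
      linarith
    · rw [bernoulli_eq_zero_of_odd ho (by have := ho.pos; omega)]
      simp; positivity

theorem bern_summable (r : ℝ) (h0 : 0 ≤ r) (hr : r < 2 * Real.pi) :
    Summable fun k => |(bernoulli k : ℝ) / k.factorial| * r ^ k := by
  have hp := Real.pi_pos
  have : Summable fun k : ℕ => 10 * (r / (2 * Real.pi)) ^ k :=
    (summable_geometric_of_lt_one (by positivity) ((div_lt_one (by positivity)).2 hr)).mul_left _
  refine Summable.of_nonneg_of_le (fun k => by positivity) (fun k => ?_) this
  calc _ ≤ 10 / (2 * Real.pi) ^ k * r ^ k := by gcongr; exact bern_bound k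
    _ = _ := by rw [div_pow]; ring

theorem bern_gen (x : ℝ) (hx : |x| < 2 * Real.pi) :
    (∑' k : ℕ, (bernoulli k : ℝ) / k.factorial * x ^ k) * (Real.exp x - 1) = x := by
  have hg : HasSum (fun n : ℕ => PowerSeries.coeff n (PowerSeries.exp ℝ - 1) * x ^ n)
      (Real.exp x - 1) := by
    have h1 : HasSum (fun n : ℕ => x ^ n / n.factorial) (Real.exp x) := by
      rw [Real.exp_eq_exp_ℝ]
      exact NormedSpace.expSeries_div_hasSum_exp x
    have h2 : HasSum (fun n : ℕ => if n = 0 then (1:ℝ) else 0) 1 := hasSum_ite_eq 0 1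
    convert! h1.sub h2 using 2 with n
    rw [map_sub, PowerSeries.coeff_exp, PowerSeries.coeff_one]
    split_ifs with h
    · subst h; simp
    · simp; ring
  have hga : Summable fun n : ℕ => ‖PowerSeries.coeff n (PowerSeries.exp ℝ - 1) * x ^ n‖ := hg.summable.norm
  have hf : Summable fun k : ℕ => (bernoulli k : ℝ) / k.factorial * x ^ k :=
    ps_sum' (fun k => (bernoulli k : ℝ) / k.factorial) (2 * Real.pi) (bern_summable) x hx
  rw [← hg.tsum_eq, tsum_mul_tsum_eq_tsum_sum_antidiagonal_of_summable_norm hf.norm hga]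
  have : ∀ n : ℕ, ∑ kl ∈ Finset.HasAntidiagonal.antidiagonal n, ((bernoulli kl.1 : ℝ) / kl.1.factorial * x ^ kl.1) *
      (PowerSeries.coeff kl.2 (PowerSeries.exp ℝ - 1) * x ^ kl.2) = if n = 1 then x else 0 := by
    intro n
    have h := congrArg (PowerSeries.coeff n) (bernoulliPowerSeries_mul_exp_sub_one ℝ)
    rw [PowerSeries.coeff_mul, PowerSeries.coeff_X] at h
    trans (if n = 1 then 1 else 0) * x ^ n
    · rw [← h, Finset.sum_mul]
      refine Finset.sum_congr rfl fun kl hkl => ?_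
      rw [← Finset.HasAntidiagonal.mem_antidiagonal.1 hkl, bernoulliPowerSeries, PowerSeries.coeff_mk, pow_add]
      simp; ring
    · split_ifs with h
      · simp [h]
      · simp
  simp_rw [this]
  simp

noncomputable def lerchA (n k : ℕ) : ℝ := (-1:ℝ) ^ k / k.factorial *
  (if k = n then ∑ j ∈ Finset.range n, (1:ℝ)/(j+1)
    else (riemannZeta (((n+1:ℕ):ℂ) - (k:ℂ))).re)

noncomputable def lerchF (n : ℕ) (x : ℝ) : ℝ :=
  ∑' k : ℕ, Real.exp (-x) ^ (k+1) / ((k:ℝ) + 1) ^ (n+1)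

theorem lerchA_zero (k : ℕ) : lerchA 0 (k+1) * ((k:ℝ)+1) =
    -((bernoulli (k+1) : ℝ) / (k+1).factorial) := by
  have h : (riemannZeta (((0+1:ℕ):ℂ) - ((k+1:ℕ):ℂ))) =
      (((-1:ℝ)^k * (bernoulli (k+1) : ℝ) / (k+1) : ℝ) : ℂ) := by
    have := riemannZeta_neg_nat_eq_bernoulli k
    push_cast
    rw [← this]; congr 1; ring
  have h1 : ((k:ℝ)+1) ≠ 0 := by positivity
  have h2 : ((k.factorial:ℕ):ℝ) ≠ 0 := by positivity
  have h3 : ((-1:ℝ)^k)^2 = 1 := by rw [← pow_mul, mul_comm, pow_mul]; simp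
  rw [lerchA, if_neg (by omega), h, Complex.ofReal_re, Nat.factorial_succ]
  push_cast
  field_simp
  rw [pow_succ]
  linear_combination (-(bernoulli (k+1) : ℝ)) * h3

theorem lerchA_succ (n k : ℕ) : lerchA (n+1) (k+1) * ((k:ℝ)+1) =
    - lerchA n k + (if k = n then (-1:ℝ)^(n+1) / (n+1).factorial else 0) := by
  have h1 : ((k:ℝ)+1) ≠ 0 := by positivity
  have h2 : ((k.factorial:ℕ):ℝ) ≠ 0 := by positivity
  have e : (((n+1+1:ℕ):ℂ) - ((k+1:ℕ):ℂ)) = (((n+1:ℕ):ℂ) - (k:ℂ)) := by push_cast; ring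
  rw [lerchA, lerchA, e, Nat.factorial_succ]
  by_cases h : k = n
  · subst h
    simp only [if_true, Finset.sum_range_succ, Nat.factorial_succ]
    push_cast
    field_simp
    ring
  · rw [if_neg (by omega), if_neg h, if_neg h]
    push_cast
    field_simp
    ring

theorem b0_summable (r : ℝ) (h0 : 0 ≤ r) (hr : r < 2 * Real.pi) :
    Summable fun k : ℕ => |-((bernoulli (k+1) : ℝ) / (k+1).factorial)| * r ^ k := by
  have hp := Real.pi_pos
  have : Summable fun k : ℕ => 10 / (2 * Real.pi) * (r / (2 * Real.pi)) ^ k :=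
    (summable_geometric_of_lt_one (by positivity) ((div_lt_one (by positivity)).2 hr)).mul_left _
  refine Summable.of_nonneg_of_le (fun k => by positivity) (fun k => ?_) this
  rw [abs_neg]
  calc _ ≤ 10 / (2 * Real.pi) ^ (k+1) * r ^ k := by gcongr; exact bern_bound (k+1)
    _ = _ := by rw [div_pow, pow_succ]; field_simp

theorem b0_tsum (x : ℝ) (h0 : 0 < x) (hx : x < 2 * Real.pi) :
    ∑' k : ℕ, -((bernoulli (k+1) : ℝ) / (k+1).factorial) * x ^ k =
      1 / x - 1 / (Real.exp x - 1) := by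
  have hx' : |x| < 2 * Real.pi := by rwa [abs_of_pos h0]
  have hg := bern_gen x hx'
  have hf : Summable fun k : ℕ => (bernoulli k : ℝ) / k.factorial * x ^ k :=
    ps_sum' (fun k => (bernoulli k : ℝ) / k.factorial) (2 * Real.pi) (bern_summable) x hx'
  rw [hf.tsum_eq_zero_add] at hg
  have e : ∑' k : ℕ, (bernoulli (k+1) : ℝ) / (k+1).factorial * x ^ (k+1) =
      - x * ∑' k : ℕ, -((bernoulli (k+1) : ℝ) / (k+1).factorial) * x ^ k := by
    rw [← tsum_mul_left]; congr 1; ext k; ring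
  rw [e] at hg
  have h1 : Real.exp x - 1 ≠ 0 := by
    have := Real.add_one_lt_exp h0.ne'; linarith
  clear e
  generalize (∑' k : ℕ, -((bernoulli (k+1) : ℝ) / (k+1).factorial) * x ^ k) = S at hg ⊢
  simp at hg
  field_simp
  linarith

theorem exp_neg_lt (x : ℝ) (h : 0 < x) : Real.exp (-x) < 1 := by
  rw [Real.exp_lt_one_iff]; linarith

theorem lerchF_summable (n : ℕ) (x : ℝ) (h : 0 < x) :
    Summable fun k : ℕ => Real.exp (-x) ^ (k+1) / ((k:ℝ) + 1) ^ (n+1) := by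
  have := (summable_nat_add_iff 1).2
    (summable_geometric_of_lt_one (Real.exp_pos (-x)).le (exp_neg_lt x h))
  refine Summable.of_nonneg_of_le (fun k => by positivity) (fun k => ?_) this
  exact div_le_self (by positivity) (one_le_pow₀ (by simp))

theorem lerchF_zero (x : ℝ) (h : 0 < x) : lerchF 0 x = -Real.log (1 - Real.exp (-x)) := by
  have := Real.hasSum_pow_div_log_of_abs_lt_one (x := Real.exp (-x))
    (by rw [abs_of_pos (Real.exp_pos _)]; exact exp_neg_lt x h)
  rw [lerchF, ← this.tsum_eq]
  simp

theorem lerchF_deriv (n : ℕ) (x : ℝ) (h : 0 < x) :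
    HasDerivAt (lerchF (n+1)) (- lerchF n x) x := by
  have hx2 : 0 < x / 2 := by positivity
  have key := hasDerivAt_tsum_of_isPreconnected (t := Set.Ioi (x/2)) (y₀ := x) (y := x)
    (g := fun (k : ℕ) x => Real.exp (-x) ^ (k+1) / ((k:ℝ) + 1) ^ (n+1+1))
    (g' := fun (k : ℕ) x => -(Real.exp (-x) ^ (k+1) / ((k:ℝ) + 1) ^ (n+1)))
    (lerchF_summable n (x/2) hx2) isOpen_Ioi isPreconnected_Ioi ?_ ?_ (by simp; linarith)
    (lerchF_summable (n+1) x h) (by simp; linarith)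
  · rw [tsum_neg] at key
    exact key
  · intro k y _
    have h1 := (((hasDerivAt_id y).neg.exp).pow (k+1)).div_const (((k:ℝ) + 1) ^ (n+1+1))
    have hk : ((k:ℝ)+1) ≠ 0 := by positivity
    convert! h1 using 1
    simp only [Nat.add_sub_cancel, Pi.neg_apply, id]
    push_cast
    field_simp
    ring
  · intro k y hy
    have hy' : x / 2 < y := hy
    rw [norm_neg, Real.norm_of_nonneg (by positivity)]
    gcongr

theorem lerchF_tendsto (n : ℕ) :
    Tendsto (lerchF (n+1)) (𝓝[>] 0) (𝓝 (riemannZeta ((n+2:ℕ):ℂ)).re) := by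
  have hs : Summable fun k : ℕ => 1 / ((k:ℝ) + 1) ^ (n+2) := by
    have := (summable_nat_add_iff 1).2 (Real.summable_one_div_nat_pow.2 (show 1 < n+2 by omega))
    simpa using this
  have hc : ContinuousOn (lerchF (n+1)) (Set.Ici 0) := by
    refine continuousOn_tsum (u := fun k : ℕ => 1 / ((k:ℝ) + 1) ^ (n+2)) ?_ hs ?_
    · intro k; fun_prop
    · intro k y hy
      have hy' : 0 ≤ y := hy
      rw [Real.norm_of_nonneg (by positivity)]
      have : Real.exp (-y) ^ (k+1) ≤ 1 := pow_le_one₀ (Real.exp_pos _).le (by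
        rw [Real.exp_le_one_iff]; linarith)
      gcongr
  have h0 : lerchF (n+1) 0 = (riemannZeta ((n+2:ℕ):ℂ)).re := by
    have h1 := zeta_nat_eq_tsum_of_gt_one (k := n+2) (by omega)
    have h2 : ∑' m : ℕ, 1 / (m:ℂ)^(n+2) = ((∑' m : ℕ, 1 / (m:ℝ)^(n+2) : ℝ) : ℂ) := by
      push_cast; rfl
    rw [h1, h2, Complex.ofReal_re,
      (Real.summable_one_div_nat_pow.2 (show 1 < n+2 by omega)).tsum_eq_zero_add]
    simp [lerchF]
  rw [← h0]
  exact (hc 0 (by simp)).mono_left (nhdsWithin_mono _ Set.Ioi_subset_Ici_self)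

theorem lerch_main (n : ℕ) :
    (∀ r, 0 ≤ r → r < 2 * Real.pi → Summable fun k => |lerchA n k| * r ^ k) ∧
    ∀ x ∈ Set.Ioo 0 (2 * Real.pi), lerchF n x =
      (-1:ℝ)^(n+1) / n.factorial * x ^ n * Real.log x + ∑' k, lerchA n k * x ^ k := by
  have hp : 0 < 2 * Real.pi := by positivity
  have hP0 : ∀ c : ℕ → ℝ, ∑' k, c k * (0:ℝ) ^ k = c 0 := by
    intro c
    rw [tsum_eq_single 0 (by intro b hb; simp [hb])]; simp
  induction n with
  | zero =>
    refine ⟨ps_summable _ _ _ b0_summable lerchA_zero, ?_⟩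
    have hd := ps_deriv _ _ _ b0_summable lerchA_zero
    have hz := zero_of_deriv
      (fun x => lerchF 0 x + Real.log x - ∑' k, lerchA 0 k * x ^ k) (2 * Real.pi) ?_ ?_
    · intro x hx
      have := hz x hx
      simp
      linarith
    · intro x hx
      have h1 : HasDerivAt (lerchF 0) (-(1 / (Real.exp x - 1))) x := by
        have hpos : 1 - Real.exp (-x) ≠ 0 := by have := exp_neg_lt x hx.1; linarith
        have h2 := (((hasDerivAt_id x).neg.exp.const_sub 1).log hpos).neg
        have h3 : HasDerivAt (lerchF 0) _ x := h2.congr_of_eventuallyEq (by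
          filter_upwards [lt_mem_nhds hx.1] with y hy using lerchF_zero y hy)
        convert! h3 using 1
        have h4 : Real.exp x - 1 ≠ 0 := by
          have := Real.add_one_lt_exp hx.1.ne'; have := hx.1; linarith
        have h5 : Real.exp (-x) * Real.exp x = 1 := by rw [← Real.exp_add]; simp
        simp only [Pi.neg_apply, id] at *
        field_simp
        linear_combination h5
      have h2 := (h1.add (Real.hasDerivAt_log hx.1.ne')).sub
        (hd x (by rw [abs_of_pos hx.1]; exact hx.2))
      convert! h2 using 1
      rw [b0_tsum x hx.1 hx.2]
      ring
    · have h1 : Tendsto (fun x => ∑' k, lerchA 0 k * x ^ k) (𝓝[>] 0) (𝓝 0) := by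
        have := (hd 0 (by simpa using hp)).continuousAt.tendsto
        rw [hP0] at this
        have e : lerchA 0 0 = 0 := by simp [lerchA]
        rw [e] at this
        exact this.mono_left nhdsWithin_le_nhds
      have h2 : Tendsto (fun x => lerchF 0 x + Real.log x) (𝓝[>] 0) (𝓝 0) := by
        have h3 : HasDerivAt (fun x : ℝ => 1 - Real.exp (-x)) 1 0 := by
          have := ((hasDerivAt_id (0:ℝ)).neg.exp.const_sub 1)
          convert! this using 1
          simp
        have h4 := h3.tendsto_slope_zero_right
        have h5 := (h4.log one_ne_zero).neg
        simp only [Real.log_one, neg_zero] at h5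
        refine h5.congr' ?_
        filter_upwards [self_mem_nhdsWithin] with y hy
        have hy' : 0 < y := hy
        have hpos : 1 - Real.exp (-y) ≠ 0 := by have := exp_neg_lt y hy'; linarith
        rw [lerchF_zero y hy']
        simp
        rw [Real.log_mul (by positivity) hpos, Real.log_inv]
        ring
      simpa using h2.sub h1
  | succ n ih =>
    obtain ⟨ihs, ihF⟩ := ih
    set C : ℝ := (-1:ℝ)^(n+1) / (n+1).factorial with hC
    have hfin : ∀ x : ℝ, HasSum (fun k => (if k = n then C else 0) * x ^ k) (C * x ^ n) := by
      intro x
      have := hasSum_ite_eq n (C * x ^ n)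
      refine this.congr_fun ?_ |> fun h => h
      intro k
      split_ifs with h
      · rw [h]
      · simp
    have hbs : ∀ r, 0 ≤ r → r < 2 * Real.pi → Summable fun k =>
        |- lerchA n k + (if k = n then C else 0)| * r ^ k := by
      intro r h0 hr
      have h1 := (ihs r h0 hr).add ((hfin r).summable.norm)
      refine Summable.of_nonneg_of_le (fun k => by positivity) (fun k => ?_) h1
      rw [norm_mul, norm_pow, Real.norm_of_nonneg h0, ← add_mul, Real.norm_eq_abs]
      gcongr
      exact (abs_add_le _ _).trans (by rw [abs_neg])
    refine ⟨ps_summable _ _ _ hbs (lerchA_succ n), ?_⟩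
    have hd := ps_deriv _ _ _ hbs (lerchA_succ n)
    have hz := zero_of_deriv
      (fun x => lerchF (n+1) x - ((-1:ℝ)^(n+1+1) / (n+1).factorial * x ^ (n+1) * Real.log x
        + ∑' k, lerchA (n+1) k * x ^ k)) (2 * Real.pi) ?_ ?_
    · intro x hx
      have := hz x hx
      linarith
    · intro x hx
      have hx' : |x| < 2 * Real.pi := by rw [abs_of_pos hx.1]; exact hx.2
      have hx0 := hx.1.ne'
      have h1 := (lerchF_deriv n x hx.1).sub
        ((((hasDerivAt_pow (n+1) x).const_mul ((-1:ℝ)^(n+1+1) / (n+1).factorial)).mul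
          (Real.hasDerivAt_log hx0)).add (hd x hx'))
      convert! h1 using 1
      have e : ∑' k, (- lerchA n k + (if k = n then C else 0)) * x ^ k =
          - (∑' k, lerchA n k * x ^ k) + C * x ^ n := by
        have := ((ps_sum' _ _ ihs x hx').hasSum.neg.add (hfin x)).tsum_eq
        rw [← this]
        congr 1; ext k; ring
      rw [e, ihF x hx, hC, Nat.factorial_succ]
      have h2 : ((n.factorial:ℕ):ℝ) ≠ 0 := by positivity
      have h3 : ((n:ℝ)+1) ≠ 0 := by positivity
      push_cast
      field_simp
      ring
    · have h1 : Tendsto (fun x => ∑' k, lerchA (n+1) k * x ^ k) (𝓝[>] 0)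
          (𝓝 (riemannZeta ((n+2:ℕ):ℂ)).re) := by
        have := (hd 0 (by simpa using hp)).continuousAt.tendsto
        rw [hP0] at this
        have e : lerchA (n+1) 0 = (riemannZeta ((n+2:ℕ):ℂ)).re := by simp [lerchA]; norm_num; ring_nf
        rw [e] at this
        exact this.mono_left nhdsWithin_le_nhds
      have h2 : Tendsto (fun x : ℝ => (-1:ℝ)^(n+1+1) / (n+1).factorial * x ^ (n+1) * Real.log x)
          (𝓝[>] 0) (𝓝 0) := by
        have := tendsto_log_mul_rpow_nhdsGT_zero (r := ((n+1:ℕ):ℝ)) (by positivity)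
        have := this.const_mul ((-1:ℝ)^(n+1+1) / (n+1).factorial)
        rw [mul_zero] at this
        refine this.congr fun x => ?_
        rw [Real.rpow_natCast]; ring
      simpa using (lerchF_tendsto n).sub (h2.add h1)

theorem lerch_formula (m : ℕ) (hm : 1 ≤ m) (t : ℝ) (ht : t ∈ Set.Ioo (0:ℝ) 1)
    (hL : Real.log (1/t) < 2 * Real.pi) :
    ∑' k : ℕ, t ^ (k+1) / ((k:ℝ) + 1) ^ m
      = ((-1:ℝ) ^ m / (m-1).factorial) * (Real.log (1/t)) ^ (m-1)
          * Real.log (Real.log (1/t))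
        + ∑' k : ℕ, ((-1:ℝ) ^ k / k.factorial) *
            (if k = m - 1 then ∑ j ∈ Finset.range (m-1), (1:ℝ)/(j+1)
             else (riemannZeta ((m:ℂ) - (k:ℂ))).re) * (Real.log (1/t)) ^ k := by
  obtain ⟨n, rfl⟩ : ∃ n, m = n + 1 := ⟨m - 1, by omega⟩
  have hpos : 0 < Real.log (1/t) := Real.log_pos (by rw [lt_div_iff₀ ht.1]; linarith [ht.2])
  have h := (lerch_main n).2 _ ⟨hpos, hL⟩
  have he : Real.exp (-Real.log (1/t)) = t := by
    rw [one_div, Real.log_inv, neg_neg, Real.exp_log ht.1]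
  rw [lerchF, he] at h
  exact h
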